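/- arXiv:2503.10934 — 6 statements merged into one kernel-verified Lean document; each statement's English description precedes it below -/
import Mathlib

section
/- Suppose x̲_{ij} ≤ x_{ij} ≤ x̄_{ij} for every movement (i,j), 0 ≤ C̲_{ij} ≤ C_{ij} ≤ C̄_{ij}, 0 ≤ R̲_{ij} ≤ R_{ij} ≤ R̄_{ij}, 0 ≤ λ̲_i ≤ λ_i ≤ λ̄_i for every entry link i, all states are nonnegative, and S has entries in [0,1]. Then for every movement (i,j): F_{ij}(x̲,S,λ̲;C̲,C̄,R̲) ≤ f_{ij}(x,S,λ;C,R) ≤ F_{ij}(x̄,S,λ̄;C̄,C̲,R̄). -/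
open Finset

/-- The set of input links of link `i`: those links `k` whose output set contains `i`. -/
def Lin {L : Type*} [Fintype L] [DecidableEq L] (out : L → Finset L) (i : L) : Finset L :=
  Finset.univ.filter (fun k => i ∈ out k)

/-- One-step traffic dynamics `f(x,S,λ;C,R)`, componentwise on movements. -/
noncomputable def fdyn {L : Type*} [Fintype L] [DecidableEq L]
    (Lint : Finset L) (out : L → Finset L)
    (x S C R : L → L → ℝ) (lam : L → ℝ) (i j : L) : ℝ :=
  if i ∈ Lint then
    max (x i j - C i j * S i j) 0 + ∑ k ∈ Lin out i, R i j * min (C k i * S k i) (x k i)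
  else
    max (x i j - C i j * S i j) 0 + R i j * lam i

/-- Augmented dynamics `F(x,S,λ;C,C̃,R)`: the saturation rate appearing with a negative
sign is replaced by `Ct`. -/
noncomputable def Faug {L : Type*} [Fintype L] [DecidableEq L]
    (Lint : Finset L) (out : L → Finset L)
    (x S C Ct R : L → L → ℝ) (lam : L → ℝ) (i j : L) : ℝ :=
  if i ∈ Lint then
    max (x i j - Ct i j * S i j) 0 + ∑ k ∈ Lin out i, R i j * min (C k i * S k i) (x k i)
  else
    max (x i j - Ct i j * S i j) 0 + R i j * lam i

/-- 1-norm of a state over all movements. -/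
noncomputable def norm1 {L : Type*} (Lem : Finset L) (out : L → Finset L)
    (x : L → L → ℝ) : ℝ :=
  ∑ i ∈ Lem, ∑ j ∈ out i, |x i j|

/-- Squared 2-norm of a state over all movements. -/
noncomputable def norm2sq {L : Type*} (Lem : Finset L) (out : L → Finset L)
    (x : L → L → ℝ) : ℝ :=
  ∑ i ∈ Lem, ∑ j ∈ out i, (x i j) ^ 2

/-- 2-norm of a state over all movements. -/
noncomputable def norm2 {L : Type*} (Lem : Finset L) (out : L → Finset L)
    (x : L → L → ℝ) : ℝ :=
  Real.sqrt (norm2sq Lem out x)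

/-- The one-step MPC Lyapunov-type cost `V(x,S)`. -/
noncomputable def Vcost {L : Type*} [Fintype L] [DecidableEq L]
    (Lentry Lint : Finset L) (out : L → Finset L) (eps : ℝ)
    (x S C R : L → L → ℝ) (lam : L → ℝ) : ℝ :=
  eps * norm1 (Lentry ∪ Lint) out x + (∑ i ∈ Lentry, (lam i) ^ 2)
    + ∑ i ∈ Lentry, ∑ j ∈ out i,
        ((x i j) ^ 2 + 2 * R i j * lam i * x i j
          + (C i j) ^ 2 * (S i j) ^ 2 - 2 * C i j * S i j * x i j)
    + ∑ i ∈ Lint, ∑ j ∈ out i, (fdyn Lint out x S C R lam i j) ^ 2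

/-- the augmented dynamics bound the true dynamics componentwise. -/
theorem augmented_dynamics_bounds {L : Type*} [Fintype L] [DecidableEq L]
    (Lentry Lint : Finset L) (out : L → Finset L)
    (hout : ∀ k i, i ∈ out k → k ∈ Lentry ∪ Lint)
    (x xlo xhi S C Clo Chi R Rlo Rhi : L → L → ℝ) (lam lamlo lamhi : L → ℝ)
    (hx : ∀ i ∈ Lentry ∪ Lint, ∀ j ∈ out i, xlo i j ≤ x i j ∧ x i j ≤ xhi i j)
    (hxpos : ∀ i ∈ Lentry ∪ Lint, ∀ j ∈ out i, 0 ≤ xlo i j)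
    (hC : ∀ i ∈ Lentry ∪ Lint, ∀ j ∈ out i,
      0 ≤ Clo i j ∧ Clo i j ≤ C i j ∧ C i j ≤ Chi i j)
    (hR : ∀ i ∈ Lentry ∪ Lint, ∀ j ∈ out i,
      0 ≤ Rlo i j ∧ Rlo i j ≤ R i j ∧ R i j ≤ Rhi i j)
    (hlam : ∀ i ∈ Lentry, 0 ≤ lamlo i ∧ lamlo i ≤ lam i ∧ lam i ≤ lamhi i)
    (hS : ∀ i j, S i j ∈ Set.Icc (0 : ℝ) 1) :
    ∀ i ∈ Lentry ∪ Lint, ∀ j ∈ out i,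
      Faug Lint out xlo S Clo Chi Rlo lamlo i j ≤ fdyn Lint out x S C R lam i j ∧
      fdyn Lint out x S C R lam i j ≤ Faug Lint out xhi S Chi Clo Rhi lamhi i j := by
  have hS0 : ∀ i j, 0 ≤ S i j := fun i j => (hS i j).1
  intro i hi j hj
  obtain ⟨hxl, hxh⟩ := hx i hi j hj
  obtain ⟨hC0, hCl, hCh⟩ := hC i hi j hj
  obtain ⟨hR0, hRl, hRh⟩ := hR i hi j hj
  have hSij := hS0 i j
  unfold Faug fdyn
  split_ifs with hint
  · have hflow : ∀ k ∈ Lin out i,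
        0 ≤ min (Clo k i * S k i) (xlo k i) ∧
        min (Clo k i * S k i) (xlo k i) ≤ min (C k i * S k i) (x k i) ∧
        min (C k i * S k i) (x k i) ≤ min (Chi k i * S k i) (xhi k i) := by
      intro k hk
      have hik : i ∈ out k := by simpa [Lin] using hk
      have hkm := hout k i hik
      obtain ⟨h0, hl, hh⟩ := hC k hkm i hik
      obtain ⟨hl', hh'⟩ := hx k hkm i hik
      have hSki := hS0 k i
      exact ⟨le_min (mul_nonneg h0 hSki) (hxpos k hkm i hik),
        min_le_min (mul_le_mul_of_nonneg_right hl hSki) hl',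
        min_le_min (mul_le_mul_of_nonneg_right hh hSki) hh'⟩
    constructor
    · refine add_le_add (by gcongr) (Finset.sum_le_sum fun k hk => ?_)
      obtain ⟨h0, hl, -⟩ := hflow k hk
      exact mul_le_mul hRl hl h0 (hR0.trans hRl)
    · refine add_le_add (by gcongr) (Finset.sum_le_sum fun k hk => ?_)
      obtain ⟨h0, hl, hh⟩ := hflow k hk
      exact mul_le_mul hRh hh (h0.trans hl) ((hR0.trans hRl).trans hRh)
  · obtain ⟨h0, hl, hh⟩ := hlam i ((Finset.mem_union.1 hi).resolve_right hint)
    constructor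
    · exact add_le_add (by gcongr) (mul_le_mul hRl hl h0 (hR0.trans hRl))
    · exact add_le_add (by gcongr)
        (mul_le_mul hRh hh (h0.trans hl) ((hR0.trans hRl).trans hRh))
end

section
/- Let 0 ≤ C̲_{ij} ≤ C_{ij} ≤ C̄_{ij}, 0 ≤ R̲_{ij} ≤ R_{ij} ≤ R̄_{ij} for all movements (i,j), and 0 ≤ λ̲_i ≤ λ_i(t) ≤ λ̄_i for all entry links i and all times t. Let S(t) be any sequence of signal matrices with entries in [0,1], and define the trajectories x(t+1) = f(x(t),S(t),λ(t);C,R), x̄(t+1) = F(x̄(t),S(t),λ̄;C̄,C̲,R̄), and x̲(t+1) = F(x̲(t),S(t),λ̲;C̲,C̄,R̲). If x̲(0) ≤ x(0) ≤ x̄(0) componentwise with all three initial states nonnegative, then x̲(t) ≤ x(t) ≤ x̄(t) componentwise for all t ≥ 0. -/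
open Finset

theorem fdyn_eq_Faug {L : Type*} [Fintype L] [DecidableEq L]
    (Lint : Finset L) (out : L → Finset L) (x S C R : L → L → ℝ) (lam : L → ℝ) (i j : L) :
    fdyn Lint out x S C R lam i j = Faug Lint out x S C C R lam i j :=
  rfl

theorem Faug_nonneg {L : Type*} [Fintype L] [DecidableEq L]
    {Lint : Finset L} {out : L → Finset L} {x S C Ct R : L → L → ℝ} {lam : L → ℝ} {i j : L}
    (hx : ∀ k, i ∈ out k → 0 ≤ x k i) (hS : ∀ k, 0 ≤ S k i)
    (hC : ∀ k, i ∈ out k → 0 ≤ C k i) (hR : 0 ≤ R i j) (hlam : i ∉ Lint → 0 ≤ lam i) :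
    0 ≤ Faug Lint out x S C Ct R lam i j := by
  unfold Faug
  split_ifs with hi
  · refine add_nonneg (le_max_right _ _) (sum_nonneg fun k hk => ?_)
    have hk' : i ∈ out k := (mem_filter.mp hk).2
    exact mul_nonneg hR (le_min (mul_nonneg (hC k hk') (hS k)) (hx k hk'))
  · exact add_nonneg (le_max_right _ _) (mul_nonneg hR (hlam hi))

/-- The augmented dynamics is monotone in the state, the inflow saturation rates, the turn
ratios and the demands, and antitone in the outflow saturation rates. -/
theorem Faug_le_Faug {L : Type*} [Fintype L] [DecidableEq L]
    {Lint : Finset L} {out : L → Finset L} {x x' S C C' Ct Ct' R R' : L → L → ℝ}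
    {lam lam' : L → ℝ} {i j : L}
    (hxij : x i j ≤ x' i j) (hx0 : ∀ k, i ∈ out k → 0 ≤ x k i)
    (hx : ∀ k, i ∈ out k → x k i ≤ x' k i) (hS : ∀ k l, 0 ≤ S k l)
    (hC0 : ∀ k, i ∈ out k → 0 ≤ C k i) (hC : ∀ k, i ∈ out k → C k i ≤ C' k i)
    (hCt : Ct' i j ≤ Ct i j) (hR0 : 0 ≤ R i j) (hR : R i j ≤ R' i j)
    (hlam0 : i ∉ Lint → 0 ≤ lam i) (hlam : i ∉ Lint → lam i ≤ lam' i) :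
    Faug Lint out x S C Ct R lam i j ≤ Faug Lint out x' S C' Ct' R' lam' i j := by
  have hmax : max (x i j - Ct i j * S i j) 0 ≤ max (x' i j - Ct' i j * S i j) 0 :=
    max_le_max (sub_le_sub hxij (mul_le_mul_of_nonneg_right hCt (hS i j))) le_rfl
  unfold Faug
  split_ifs with hi
  · refine add_le_add hmax (sum_le_sum fun k hk => ?_)
    have hk' : i ∈ out k := (mem_filter.mp hk).2
    exact mul_le_mul hR
      (min_le_min (mul_le_mul_of_nonneg_right (hC k hk') (hS k i)) (hx k hk'))
      (le_min (mul_nonneg (hC0 k hk') (hS k i)) (hx0 k hk')) (hR0.trans hR)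
  · exact add_le_add hmax (mul_le_mul hR (hlam hi) (hlam0 hi) (hR0.trans hR))

/-- trajectories of the augmented dynamics sandwich the true trajectory
at every time. -/
theorem augmented_trajectory_bounds {L : Type*} [Fintype L] [DecidableEq L]
    (Lentry Lint : Finset L) (out : L → Finset L)
    (hout : ∀ k i, i ∈ out k → k ∈ Lentry ∪ Lint)
    (C Clo Chi R Rlo Rhi : L → L → ℝ) (lamlo lamhi : L → ℝ) (lam : ℕ → L → ℝ)
    (S : ℕ → L → L → ℝ)
    (hC : ∀ i ∈ Lentry ∪ Lint, ∀ j ∈ out i,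
      0 ≤ Clo i j ∧ Clo i j ≤ C i j ∧ C i j ≤ Chi i j)
    (hR : ∀ i ∈ Lentry ∪ Lint, ∀ j ∈ out i,
      0 ≤ Rlo i j ∧ Rlo i j ≤ R i j ∧ R i j ≤ Rhi i j)
    (hlam : ∀ t, ∀ i ∈ Lentry, 0 ≤ lamlo i ∧ lamlo i ≤ lam t i ∧ lam t i ≤ lamhi i)
    (hS : ∀ t i j, S t i j ∈ Set.Icc (0 : ℝ) 1)
    (x xlo xhi : ℕ → L → L → ℝ)
    (hdyn : ∀ t, ∀ i ∈ Lentry ∪ Lint, ∀ j ∈ out i,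
      x (t + 1) i j = fdyn Lint out (x t) (S t) C R (lam t) i j)
    (hdynhi : ∀ t, ∀ i ∈ Lentry ∪ Lint, ∀ j ∈ out i,
      xhi (t + 1) i j = Faug Lint out (xhi t) (S t) Chi Clo Rhi lamhi i j)
    (hdynlo : ∀ t, ∀ i ∈ Lentry ∪ Lint, ∀ j ∈ out i,
      xlo (t + 1) i j = Faug Lint out (xlo t) (S t) Clo Chi Rlo lamlo i j)
    (h0 : ∀ i ∈ Lentry ∪ Lint, ∀ j ∈ out i,
      xlo 0 i j ≤ x 0 i j ∧ x 0 i j ≤ xhi 0 i j)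
    (h0pos : ∀ i ∈ Lentry ∪ Lint, ∀ j ∈ out i,
      0 ≤ xlo 0 i j ∧ 0 ≤ x 0 i j ∧ 0 ≤ xhi 0 i j) :
    ∀ t, ∀ i ∈ Lentry ∪ Lint, ∀ j ∈ out i,
      xlo t i j ≤ x t i j ∧ x t i j ≤ xhi t i j := by
  have hS0 : ∀ t k l, 0 ≤ S t k l := fun t k l => (hS t k l).1
  suffices h : ∀ t, ∀ i ∈ Lentry ∪ Lint, ∀ j ∈ out i,
      0 ≤ xlo t i j ∧ xlo t i j ≤ x t i j ∧ x t i j ≤ xhi t i j from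
    fun t i hi j hj => (h t i hi j hj).2
  intro t
  induction t with
  | zero => exact fun i hi j hj => ⟨(h0pos i hi j hj).1, h0 i hi j hj⟩
  | succ t ih =>
    intro i hi j hj
    have hin : ∀ k, i ∈ out k → 0 ≤ xlo t k i ∧ xlo t k i ≤ x t k i ∧ x t k i ≤ xhi t k i :=
      fun k hk => ih k (hout k i hk) i hk
    have hCin : ∀ k, i ∈ out k → 0 ≤ Clo k i ∧ Clo k i ≤ C k i ∧ C k i ≤ Chi k i :=
      fun k hk => hC k (hout k i hk) i hk
    have hlam' : i ∉ Lint → 0 ≤ lamlo i ∧ lamlo i ≤ lam t i ∧ lam t i ≤ lamhi i :=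
      fun h => hlam t i ((mem_union.mp hi).resolve_right h)
    obtain ⟨-, hxl, hxh⟩ := ih i hi j hj
    obtain ⟨-, hCl, hCh⟩ := hC i hi j hj
    obtain ⟨hR0, hRl, hRh⟩ := hR i hi j hj
    rw [hdyn t i hi j hj, hdynhi t i hi j hj, hdynlo t i hi j hj, fdyn_eq_Faug]
    refine ⟨?_, ?_, ?_⟩
    · exact Faug_nonneg (fun k hk => (hin k hk).1) (fun k => hS0 t k i)
        (fun k hk => (hCin k hk).1) hR0 (fun h => (hlam' h).1)
    · exact Faug_le_Faug hxl (fun k hk => (hin k hk).1) (fun k hk => (hin k hk).2.1) (hS0 t)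
        (fun k hk => (hCin k hk).1) (fun k hk => (hCin k hk).2.1) hCh hR0 hRl
        (fun h => (hlam' h).1) (fun h => (hlam' h).2.1)
    · exact Faug_le_Faug hxh (fun k hk => (hin k hk).1.trans (hin k hk).2.1)
        (fun k hk => (hin k hk).2.2) (hS0 t)
        (fun k hk => (hCin k hk).1.trans (hCin k hk).2.1) (fun k hk => (hCin k hk).2.2)
        hCl (hR0.trans hRl) hRh
        (fun h => (hlam' h).1.trans (hlam' h).2.1) (fun h => (hlam' h).2.2)
end

section
/- Suppose the state x is nonnegative, S has entries in [0,1], C ≥ 0, λ ≥ 0, R ≥ 0, and Σ_{j∈L_i^out} R_{ij} ≤ 1 for every entry link i. Then for every ε > 0, V(x,S) ≥ ε‖x‖₁ + ‖f(x,S,λ;C,R)‖₂². In particular, V(x,S) ≥ ε‖x‖₂ for every S, hence inf_S V(x,S) ≥ ε‖x‖₂. -/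
open Finset

/-- The 2-norm of a finite real family is at most its 1-norm. -/
lemma norm2_le_norm1 {L : Type*} (Lem : Finset L) (out : L → Finset L) (x : L → L → ℝ) :
    norm2 Lem out x ≤ norm1 Lem out x := by
  refine Real.sqrt_le_iff.mpr
    ⟨Finset.sum_nonneg fun i _ => Finset.sum_nonneg fun j _ => abs_nonneg _, ?_⟩
  calc norm2sq Lem out x = ∑ i ∈ Lem, ∑ j ∈ out i, |x i j| ^ 2 := by simp [norm2sq, sq_abs]
    _ ≤ ∑ i ∈ Lem, (∑ j ∈ out i, |x i j|) ^ 2 :=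
        Finset.sum_le_sum fun i _ => Finset.sum_sq_le_sq_sum_of_nonneg fun j _ => abs_nonneg _
    _ ≤ (norm1 Lem out x) ^ 2 :=
        Finset.sum_sq_le_sq_sum_of_nonneg fun i _ => Finset.sum_nonneg fun j _ => abs_nonneg _

lemma norm2sq_nonneg {L : Type*} (Lem : Finset L) (out : L → Finset L) (x : L → L → ℝ) :
    0 ≤ norm2sq Lem out x :=
  Finset.sum_nonneg fun _ _ => Finset.sum_nonneg fun _ _ => sq_nonneg _

/-- A truncated queue plus an inflow `a` has square at most the untruncated expansion. -/
lemma sq_max_sub_add_le {x c a : ℝ} (hx : 0 ≤ x) (hc : 0 ≤ c) (ha : 0 ≤ a) :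
    (max (x - c) 0 + a) ^ 2 ≤ (x - c) ^ 2 + 2 * a * x + a ^ 2 := by
  have hle : max (x - c) 0 ≤ x := max_le (by linarith) hx
  have hsq : (max (x - c) 0) ^ 2 ≤ (x - c) ^ 2 :=
    sq_le_sq.mpr <| by
      rw [abs_of_nonneg (le_max_right _ _)]
      exact max_le (le_abs_self _) (abs_nonneg _)
  nlinarith [mul_le_mul_of_nonneg_left hle ha]

/-- Nonnegative weights of total mass at most one have square sum at most one. -/
lemma sum_sq_le_one {ι : Type*} {s : Finset ι} {r : ι → ℝ} (h0 : ∀ j ∈ s, 0 ≤ r j)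
    (h1 : ∑ j ∈ s, r j ≤ 1) : ∑ j ∈ s, r j ^ 2 ≤ 1 :=
  (Finset.sum_sq_le_sq_sum_of_nonneg h0).trans
    (pow_le_one₀ (Finset.sum_nonneg h0) h1)

/-- The one-step bound `ε‖x‖₁ + ‖f(x,S,λ)‖₂² ≤ V(x,S)` for a fixed signal matrix. -/
lemma norm1_add_norm2sq_fdyn_le_Vcost {L : Type*} [Fintype L] [DecidableEq L]
    {Lentry Lint : Finset L} {out : L → Finset L} (hdisj : Disjoint Lentry Lint)
    {x S C R : L → L → ℝ} {lam : L → ℝ} (eps : ℝ)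
    (hx : ∀ i ∈ Lentry, ∀ j ∈ out i, 0 ≤ x i j)
    (hC : ∀ i ∈ Lentry, ∀ j ∈ out i, 0 ≤ C i j)
    (hR : ∀ i ∈ Lentry, ∀ j ∈ out i, 0 ≤ R i j)
    (hlam : ∀ i ∈ Lentry, 0 ≤ lam i)
    (hRsum : ∀ i ∈ Lentry, ∑ j ∈ out i, R i j ≤ 1)
    (hS : ∀ i j, 0 ≤ S i j) :
    eps * norm1 (Lentry ∪ Lint) out x
        + norm2sq (Lentry ∪ Lint) out (fdyn Lint out x S C R lam)
      ≤ Vcost Lentry Lint out eps x S C R lam := by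
  have hentry : ∑ i ∈ Lentry, ∑ j ∈ out i, (fdyn Lint out x S C R lam i j) ^ 2 ≤
      (∑ i ∈ Lentry, (lam i) ^ 2) + ∑ i ∈ Lentry, ∑ j ∈ out i,
        ((x i j) ^ 2 + 2 * R i j * lam i * x i j
          + (C i j) ^ 2 * (S i j) ^ 2 - 2 * C i j * S i j * x i j) := by
    rw [← Finset.sum_add_distrib]
    refine Finset.sum_le_sum fun i hi => ?_
    have hR2 : ∑ j ∈ out i, (R i j * lam i) ^ 2 ≤ lam i ^ 2 := by
      simp_rw [mul_pow]
      rw [← Finset.sum_mul]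
      exact mul_le_of_le_one_left (sq_nonneg _) (sum_sq_le_one (hR i hi) (hRsum i hi))
    refine le_trans ?_ (add_le_add_left hR2 _)
    rw [← Finset.sum_add_distrib]
    refine Finset.sum_le_sum fun j hj => ?_
    rw [fdyn, if_neg (Finset.disjoint_left.mp hdisj hi)]
    refine (sq_max_sub_add_le (hx i hi j hj) (mul_nonneg (hC i hi j hj) (hS i j))
      (mul_nonneg (hR i hi j hj) (hlam i hi))).trans_eq ?_
    ring
  rw [norm2sq, Finset.sum_union hdisj, Vcost]
  linarith

/-- lower bound on the MPC cost `V(x,S)`, and hence on its infimum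
over signal matrices. -/
theorem Vcost_lower_bound {L : Type*} [Fintype L] [DecidableEq L]
    (Lentry Lint : Finset L) (out : L → Finset L)
    (hout : ∀ k i, i ∈ out k → k ∈ Lentry ∪ Lint)
    (hdisj : Disjoint Lentry Lint)
    (x C R : L → L → ℝ) (lam : L → ℝ) (eps : ℝ) (heps : 0 < eps)
    (hx : ∀ i ∈ Lentry ∪ Lint, ∀ j ∈ out i, 0 ≤ x i j)
    (hC : ∀ i ∈ Lentry ∪ Lint, ∀ j ∈ out i, 0 ≤ C i j)
    (hR : ∀ i ∈ Lentry ∪ Lint, ∀ j ∈ out i, 0 ≤ R i j)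
    (hlam : ∀ i ∈ Lentry, 0 ≤ lam i)
    (hRsum : ∀ i ∈ Lentry, ∑ j ∈ out i, R i j ≤ 1) :
    (∀ S : L → L → ℝ, (∀ i j, S i j ∈ Set.Icc (0 : ℝ) 1) →
      eps * norm1 (Lentry ∪ Lint) out x
          + norm2sq (Lentry ∪ Lint) out (fdyn Lint out x S C R lam)
        ≤ Vcost Lentry Lint out eps x S C R lam ∧
      eps * norm2 (Lentry ∪ Lint) out x ≤ Vcost Lentry Lint out eps x S C R lam) ∧
    eps * norm2 (Lentry ∪ Lint) out x ≤
      sInf {v : ℝ | ∃ S : L → L → ℝ, (∀ i j, S i j ∈ Set.Icc (0 : ℝ) 1) ∧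
        v = Vcost Lentry Lint out eps x S C R lam} := by
  have bound : ∀ S : L → L → ℝ, (∀ i j, S i j ∈ Set.Icc (0 : ℝ) 1) →
      eps * norm1 (Lentry ∪ Lint) out x
          + norm2sq (Lentry ∪ Lint) out (fdyn Lint out x S C R lam)
        ≤ Vcost Lentry Lint out eps x S C R lam ∧
      eps * norm2 (Lentry ∪ Lint) out x ≤ Vcost Lentry Lint out eps x S C R lam := by
    intro S hS
    have h := norm1_add_norm2sq_fdyn_le_Vcost hdisj eps
      (fun i hi => hx i (Finset.mem_union_left _ hi))
      (fun i hi => hC i (Finset.mem_union_left _ hi))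
      (fun i hi => hR i (Finset.mem_union_left _ hi)) hlam hRsum (fun i j => (hS i j).1)
    have hnorm := mul_le_mul_of_nonneg_left (norm2_le_norm1 (Lentry ∪ Lint) out x) heps.le
    exact ⟨h, by linarith [norm2sq_nonneg (Lentry ∪ Lint) out (fdyn Lint out x S C R lam)]⟩
  refine ⟨bound, le_csInf ⟨_, fun _ _ => 0, fun _ _ => by simp, rfl⟩ ?_⟩
  rintro v ⟨S, hS, rfl⟩
  exact (bound S hS).2
end

section
/- Let 𝒮 be a nonempty compact set of signal matrices with entries in [0,1], suppose C ≥ 0, λ ≥ 0, R ≥ 0 with Σ_{j∈L_i^out} R_{ij} ≤ 1 for every i ∈ L_entry, and fix ε > 0 and k ≥ 0. Assume there exists a map S^mp assigning to every nonnegative state y an element S^mp(y) ∈ 𝒮 such that ‖f(y,S^mp(y),λ;C,R)‖₂² − ‖y‖₂² ≤ −ε‖y‖₁ + k for every nonnegative state y. Define V*(x) := min_{S∈𝒮} V(x,S), let S* ∈ 𝒮 attain this minimum at x, and let x⁺ := f(x,S*,λ;C,R). Then V*(x⁺) − V*(x) ≤ −ε‖x‖₁ + k + ‖λ‖₂² +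 Σ_{i∈L_entry, j∈L_i^out} (C_{ij}² + 2R_{ij}λ_i C_{ij}). -/
open Finset

/-- The dynamics preserve nonnegativity of the queue lengths. -/
theorem fdyn_nonneg {L : Type*} [Fintype L] [DecidableEq L]
    {Lentry Lint : Finset L} {out : L → Finset L}
    (hout : ∀ k i, i ∈ out k → k ∈ Lentry ∪ Lint)
    {x S C R : L → L → ℝ} {lam : L → ℝ}
    (hS : ∀ i j, 0 ≤ S i j)
    (hC : ∀ i ∈ Lentry ∪ Lint, ∀ j ∈ out i, 0 ≤ C i j)
    (hlam : ∀ i ∈ Lentry, 0 ≤ lam i)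
    (hR : ∀ i ∈ Lentry ∪ Lint, ∀ j ∈ out i, 0 ≤ R i j)
    (hx : ∀ i ∈ Lentry ∪ Lint, ∀ j ∈ out i, 0 ≤ x i j) :
    ∀ i ∈ Lentry ∪ Lint, ∀ j ∈ out i, 0 ≤ fdyn Lint out x S C R lam i j := by
  intro i hi j hj
  unfold fdyn
  split_ifs with h
  · refine add_nonneg (le_max_right _ _) (Finset.sum_nonneg fun k hk => ?_)
    have hik : i ∈ out k := by simpa [Lin] using hk
    have hk' := hout k i hik
    exact mul_nonneg (hR i hi j hj)
      (le_min (mul_nonneg (hC k hk' i hik) (hS k i)) (hx k hk' i hik))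
  · have hi' : i ∈ Lentry := (Finset.mem_union.mp hi).resolve_right h
    exact add_nonneg (le_max_right _ _) (mul_nonneg (hR i hi j hj) (hlam i hi'))

/-- The cost is nonnegative on nonnegative states. -/
theorem Vcost_nonneg {L : Type*} [Fintype L] [DecidableEq L]
    {Lentry Lint : Finset L} {out : L → Finset L} {eps : ℝ} (heps : 0 ≤ eps)
    {x C R : L → L → ℝ} {lam : L → ℝ}
    (hlam : ∀ i ∈ Lentry, 0 ≤ lam i)
    (hR : ∀ i ∈ Lentry, ∀ j ∈ out i, 0 ≤ R i j)
    (hx : ∀ i ∈ Lentry, ∀ j ∈ out i, 0 ≤ x i j) (S : L → L → ℝ) :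
    0 ≤ Vcost Lentry Lint out eps x S C R lam := by
  unfold Vcost norm1
  have hentry : 0 ≤ ∑ i ∈ Lentry, ∑ j ∈ out i,
      ((x i j) ^ 2 + 2 * R i j * lam i * x i j
        + (C i j) ^ 2 * (S i j) ^ 2 - 2 * C i j * S i j * x i j) := by
    refine Finset.sum_nonneg fun i hi => Finset.sum_nonneg fun j hj => ?_
    have h := mul_nonneg (mul_nonneg (hR i hi j hj) (hlam i hi)) (hx i hi j hj)
    nlinarith [sq_nonneg (x i j - C i j * S i j)]
  positivity

/-- The square of the updated entry queue, up to `(r * l) ^ 2`, is at most the entry stage cost. -/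
theorem sq_entry_update_le {x c s r l : ℝ} (hx : 0 ≤ x) (hc : 0 ≤ c) (hs : 0 ≤ s)
    (hr : 0 ≤ r) (hl : 0 ≤ l) :
    (max (x - c * s) 0 + r * l) ^ 2 ≤
      x ^ 2 + 2 * r * l * x + c ^ 2 * s ^ 2 - 2 * c * s * x + (r * l) ^ 2 := by
  have hcs := mul_nonneg hc hs
  have hrl := mul_nonneg hr hl
  have hmul := mul_nonneg hrl hx
  have hmul' := mul_nonneg hrl hcs
  rcases max_cases (x - c * s) 0 with ⟨h, _⟩ | ⟨h, _⟩ <;> rw [h] <;>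
    nlinarith [sq_nonneg (x - c * s)]

/-- The entry stage cost exceeds the square of the updated entry queue by at most
`c ^ 2 + 2 * r * l * c`. -/
theorem entry_cost_le {x c s r l : ℝ} (hx : 0 ≤ x) (hc : 0 ≤ c) (hs : 0 ≤ s) (hs1 : s ≤ 1)
    (hr : 0 ≤ r) (hl : 0 ≤ l) :
    x ^ 2 + 2 * r * l * x + c ^ 2 * s ^ 2 - 2 * c * s * x + (r * l) ^ 2 ≤
      (max (x - c * s) 0 + r * l) ^ 2 + (c ^ 2 + 2 * r * l * c) := by
  have hcs := mul_nonneg hc hs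
  have hcs1 : c * s ≤ c := mul_le_of_le_one_right hc hs1
  have hrl := mul_nonneg hr hl
  rcases max_cases (x - c * s) 0 with ⟨h, _⟩ | ⟨h, hlt⟩ <;> rw [h]
  · nlinarith [mul_le_mul_of_nonneg_left hcs1 hrl, sq_nonneg c]
  · have hxc : x ≤ c := by linarith
    have hsq : (c * s - x) ^ 2 ≤ c ^ 2 := pow_le_pow_left₀ (by linarith) (by linarith) 2
    nlinarith [mul_le_mul_of_nonneg_left hxc hrl]

/-- one-step decrease of the optimal value function `V*` along the
closed loop, given the max-pressure drift property. -/
theorem Vstar_decrease {L : Type*} [Fintype L] [DecidableEq L]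
    (Lentry Lint : Finset L) (out : L → Finset L)
    (hout : ∀ k i, i ∈ out k → k ∈ Lentry ∪ Lint)
    (hdisj : Disjoint Lentry Lint)
    (𝒮 : Set (L → L → ℝ)) (hne : 𝒮.Nonempty) (hcomp : IsCompact 𝒮)
    (hSmem : ∀ S ∈ 𝒮, ∀ i j, S i j ∈ Set.Icc (0 : ℝ) 1)
    (C R : L → L → ℝ) (lam : L → ℝ) (eps k : ℝ) (heps : 0 < eps) (hk : 0 ≤ k)
    (hC : ∀ i ∈ Lentry ∪ Lint, ∀ j ∈ out i, 0 ≤ C i j)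
    (hlam : ∀ i ∈ Lentry, 0 ≤ lam i)
    (hR : ∀ i ∈ Lentry ∪ Lint, ∀ j ∈ out i, 0 ≤ R i j)
    (hRsum : ∀ i ∈ Lentry, ∑ j ∈ out i, R i j ≤ 1)
    (Smp : (L → L → ℝ) → (L → L → ℝ))
    (hmp : ∀ y : L → L → ℝ, (∀ i ∈ Lentry ∪ Lint, ∀ j ∈ out i, 0 ≤ y i j) →
      Smp y ∈ 𝒮 ∧
      norm2sq (Lentry ∪ Lint) out (fdyn Lint out y (Smp y) C R lam)
          - norm2sq (Lentry ∪ Lint) out y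
        ≤ -eps * norm1 (Lentry ∪ Lint) out y + k)
    (x : L → L → ℝ) (hx : ∀ i ∈ Lentry ∪ Lint, ∀ j ∈ out i, 0 ≤ x i j)
    (Sstar : L → L → ℝ) (hSstar : Sstar ∈ 𝒮)
    (hmin : ∀ S ∈ 𝒮, Vcost Lentry Lint out eps x Sstar C R lam ≤
      Vcost Lentry Lint out eps x S C R lam) :
    sInf {v : ℝ | ∃ S ∈ 𝒮,
        v = Vcost Lentry Lint out eps (fdyn Lint out x Sstar C R lam) S C R lam}
      - sInf {v : ℝ | ∃ S ∈ 𝒮, v = Vcost Lentry Lint out eps x S C R lam}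
    ≤ -eps * norm1 (Lentry ∪ Lint) out x + k + (∑ i ∈ Lentry, (lam i) ^ 2)
      + ∑ i ∈ Lentry, ∑ j ∈ out i,
          ((C i j) ^ 2 + 2 * R i j * lam i * C i j) := by
  have hentry : ∀ i ∈ Lentry, i ∈ Lentry ∪ Lint := fun i hi => Finset.mem_union_left _ hi
  have hfdyn : ∀ y S : L → L → ℝ, ∀ i ∈ Lentry, ∀ j, fdyn Lint out y S C R lam i j =
      max (y i j - C i j * S i j) 0 + R i j * lam i := fun y S i hi j =>
    if_neg (Finset.disjoint_left.mp hdisj hi)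
  set y := fdyn Lint out x Sstar C R lam with hy
  have hy0 : ∀ i ∈ Lentry ∪ Lint, ∀ j ∈ out i, 0 ≤ y i j :=
    fdyn_nonneg hout (fun i j => (hSmem _ hSstar i j).1) hC hlam hR hx
  obtain ⟨hmem, hdrift⟩ := hmp y hy0
  have hVx : sInf {v : ℝ | ∃ S ∈ 𝒮, v = Vcost Lentry Lint out eps x S C R lam} =
      Vcost Lentry Lint out eps x Sstar C R lam := by
    refine IsLeast.csInf_eq ⟨⟨Sstar, hSstar, rfl⟩, ?_⟩
    rintro _ ⟨S, hS, rfl⟩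
    exact hmin S hS
  have hVy : sInf {v : ℝ | ∃ S ∈ 𝒮, v = Vcost Lentry Lint out eps y S C R lam} ≤
      Vcost Lentry Lint out eps y (Smp y) C R lam := by
    refine csInf_le ⟨0, ?_⟩ ⟨Smp y, hmem, rfl⟩
    rintro _ ⟨S, -, rfl⟩
    exact Vcost_nonneg heps.le hlam (fun i hi => hR i (hentry i hi))
      (fun i hi => hy0 i (hentry i hi)) S
  have hcurrent : ∑ i ∈ Lentry, ∑ j ∈ out i, (y i j) ^ 2 ≤
      ∑ i ∈ Lentry, ∑ j ∈ out i,
        (((x i j) ^ 2 + 2 * R i j * lam i * x i j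
          + (C i j) ^ 2 * (Sstar i j) ^ 2 - 2 * C i j * Sstar i j * x i j)
          + (R i j * lam i) ^ 2) := by
    refine Finset.sum_le_sum fun i hi => Finset.sum_le_sum fun j hj => ?_
    rw [hy, hfdyn _ _ i hi]
    exact sq_entry_update_le (hx i (hentry i hi) j hj) (hC i (hentry i hi) j hj)
      (hSmem _ hSstar i j).1 (hR i (hentry i hi) j hj) (hlam i hi)
  have hnext : ∑ i ∈ Lentry, ∑ j ∈ out i,
        (((y i j) ^ 2 + 2 * R i j * lam i * y i j
          + (C i j) ^ 2 * (Smp y i j) ^ 2 - 2 * C i j * Smp y i j * y i j)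
          + (R i j * lam i) ^ 2) ≤
      ∑ i ∈ Lentry, ∑ j ∈ out i, ((fdyn Lint out y (Smp y) C R lam i j) ^ 2
        + ((C i j) ^ 2 + 2 * R i j * lam i * C i j)) := by
    refine Finset.sum_le_sum fun i hi => Finset.sum_le_sum fun j hj => ?_
    rw [hfdyn _ _ i hi]
    exact entry_cost_le (hy0 i (hentry i hi) j hj) (hC i (hentry i hi) j hj)
      (hSmem _ hmem i j).1 (hSmem _ hmem i j).2 (hR i (hentry i hi) j hj) (hlam i hi)
  have hlamsq : 0 ≤ ∑ i ∈ Lentry, (lam i) ^ 2 := Finset.sum_nonneg fun i _ => sq_nonneg _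
  simp only [Finset.sum_add_distrib (g := fun j => (R _ j * lam _) ^ 2),
    Finset.sum_add_distrib (g := fun i => ∑ j ∈ out i, (R i j * lam i) ^ 2)] at hcurrent hnext
  rw [Finset.sum_congr rfl fun i _ => Finset.sum_add_distrib (s := out i)
    (f := fun j => (fdyn Lint out y (Smp y) C R lam i j) ^ 2), Finset.sum_add_distrib] at hnext
  unfold norm2sq at hdrift
  rw [Finset.sum_union hdisj, Finset.sum_union hdisj] at hdrift
  rw [hVx]
  unfold Vcost at hVy ⊢
  rw [← hy]
  linarith
end

section
/- Let g : ℝⁿ × ℝ^q → ℝⁿ, let μ ≥ 0, let ρ be a class-K function, and let W := {w ∈ ℝ^q : ‖w‖ ≤ ρ(μ)}. Suppose V : ℝⁿ → ℝ_{≥0} satisfies, for class-K∞ functions α₁, α₂, α₃, σ and class-K functions ρ₁, ρ₂: (i) α₁(‖x‖) ≤ V(x) ≤ α₂(‖x‖) + σ(μ) for all x ∈ ℝⁿ, and (ii) V(g(x,w)) − V(x) ≤ −α₃(‖x‖) + ρ₁(‖w‖) + ρ₂(μ) for all x ∈ ℝⁿ and all w ∈ W. Then there exist a class-KL function β and class-K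 functions δ₁, δ₂ such that every trajectory x(t+1) = g(x(t), w(t)) with w(t) ∈ W for all t satisfies ‖x(t)‖ ≤ β(‖x(0)‖, t) + δ₁(sup_{s≥0} ‖w(s)‖) + δ₂(μ) for all x(0) ∈ ℝⁿ and all t ≥ 0. -/
/-- A class-K function (restricted to `s ≥ 0`): continuous, vanishing at `0`,
strictly increasing. -/
def IsClassK (α : ℝ → ℝ) : Prop :=
  ContinuousOn α (Set.Ici 0) ∧ α 0 = 0 ∧ StrictMonoOn α (Set.Ici 0)

/-- A class-K∞ function: class K and unbounded. -/
def IsClassKInf (α : ℝ → ℝ) : Prop :=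
  IsClassK α ∧ Filter.Tendsto α Filter.atTop Filter.atTop

/-- A class-KL function `β : ℝ≥0 × ℕ → ℝ≥0` (restricted to `s ≥ 0`). -/
def IsClassKL (β : ℝ → ℕ → ℝ) : Prop :=
  (∀ t, ContinuousOn (fun s => β s t) (Set.Ici 0)) ∧
  (∀ t, β 0 t = 0) ∧
  (∀ t, StrictMonoOn (fun s => β s t) (Set.Ici 0)) ∧
  (∀ s t, 0 ≤ s → 0 ≤ β s t) ∧
  (∀ s, 0 < s → StrictAnti (fun t : ℕ => β s t)) ∧
  (∀ s, 0 < s → Filter.Tendsto (fun t : ℕ => β s t) Filter.atTop (nhds 0))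

section ComparisonFunctions

open Filter Topology Set

lemma IsClassK.nonneg {α : ℝ → ℝ} (h : IsClassK α) {s : ℝ} (hs : 0 ≤ s) : 0 ≤ α s := by
  simpa [h.2.1] using h.2.2.monotoneOn self_mem_Ici hs hs

lemma IsClassK.mono {α : ℝ → ℝ} (h : IsClassK α) {s r : ℝ} (hs : 0 ≤ s) (hsr : s ≤ r) :
    α s ≤ α r :=
  h.2.2.monotoneOn hs (hs.trans hsr) hsr

lemma IsClassK.le_of_le {α : ℝ → ℝ} (h : IsClassK α) {s r : ℝ} (hs : 0 ≤ s) (hr : 0 ≤ r)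
    (hsr : α s ≤ α r) : s ≤ r :=
  (h.2.2.le_iff_le hs hr).1 hsr

lemma IsClassK.comp {α γ : ℝ → ℝ} (hα : IsClassK α) (hγ : IsClassK γ) :
    IsClassK (fun s => α (γ s)) := by
  have hmaps : MapsTo γ (Ici 0) (Ici 0) := fun _ hs => hγ.nonneg hs
  exact ⟨hα.1.comp hγ.1 hmaps, by simp [hγ.2.1, hα.2.1], hα.2.2.comp hγ.2.2 hmaps⟩

lemma IsClassKInf.comp {α γ : ℝ → ℝ} (hα : IsClassKInf α) (hγ : IsClassKInf γ) :
    IsClassKInf (fun s => α (γ s)) :=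
  ⟨hα.1.comp hγ.1, hα.2.comp hγ.2⟩

lemma IsClassKInf.add {α γ : ℝ → ℝ} (hα : IsClassKInf α) (hγ : IsClassKInf γ) :
    IsClassKInf (fun s => α s + γ s) :=
  ⟨⟨hα.1.1.add hγ.1.1, by simp [hα.1.2.1, hγ.1.2.1],
    fun _ hs _ hr hsr => add_lt_add (hα.1.2.2 hs hr hsr) (hγ.1.2.2 hs hr hsr)⟩,
    hα.2.atTop_add_atTop hγ.2⟩

lemma isClassKInf_const_mul {c : ℝ} (hc : 0 < c) : IsClassKInf (fun s => c * s) :=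
  ⟨⟨by fun_prop, by simp, fun _ _ _ _ hsr => mul_lt_mul_of_pos_left hsr hc⟩,
    tendsto_id.const_mul_atTop hc⟩

lemma isClassKInf_id : IsClassKInf (fun s => s) := by
  simpa using isClassKInf_const_mul one_pos

lemma IsClassKInf.exists_inverse {α : ℝ → ℝ} (h : IsClassKInf α) :
    ∃ γ : ℝ → ℝ, IsClassKInf γ ∧ (∀ s, 0 ≤ s → α (γ s) = s) ∧ ∀ s, 0 ≤ s → γ (α s) = s := by
  let f : ℝ → ℝ := fun s => if s < 0 then s else α s
  have hf : ∀ s, 0 ≤ s → f s = α s := fun s hs => if_neg hs.not_gt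
  have hneg : ∀ s, s < 0 → f s = s := fun s hs => if_pos hs
  have hmono : StrictMono f := by
    intro s r hsr
    rcases lt_or_ge s 0 with hs | hs
    · rcases lt_or_ge r 0 with hr | hr
      · rwa [hneg s hs, hneg r hr]
      · rw [hneg s hs, hf r hr]
        exact hs.trans_le (h.1.nonneg hr)
    · have hr := hs.trans hsr.le
      rw [hf s hs, hf r hr]
      exact h.1.2.2 hs hr hsr
  have hsurj : Function.Surjective f := by
    intro y
    rcases lt_or_ge y 0 with hy | hy
    · exact ⟨y, hneg y hy⟩
    · obtain ⟨M, hM, hM0⟩ := ((h.2.eventually_ge_atTop y).and (eventually_ge_atTop 0)).exists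
      obtain ⟨s, hs, hsy⟩ := intermediate_value_Icc hM0 (h.1.1.mono Icc_subset_Ici_self)
        (show y ∈ Icc (α 0) (α M) from ⟨by rwa [h.1.2.1], hM⟩)
      exact ⟨s, by rw [hf s hs.1, hsy]⟩
  let e : ℝ ≃o ℝ := hmono.orderIsoOfSurjective f hsurj
  have he : ∀ s, 0 ≤ s → e.symm (α s) = s := fun s hs => by
    rw [← hf s hs]
    exact e.symm_apply_apply s
  have he0 : e.symm 0 = 0 := by simpa [h.1.2.1] using he 0 le_rfl
  refine ⟨e.symm, ⟨⟨e.symm.continuous.continuousOn, he0, e.symm.strictMono.strictMonoOn _⟩,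
    e.symm.tendsto_atTop⟩, fun s hs => ?_, he⟩
  have hs' : 0 ≤ e.symm s := he0 ▸ e.symm.monotone hs
  rw [← hf _ hs']
  exact e.apply_symm_apply s

lemma IsClassK.isClassKL_comp_div {ψ α : ℝ → ℝ} (hψ : IsClassK ψ) (hα : IsClassK α) :
    IsClassKL (fun s t => ψ (α s / (t + 1))) := by
  have hk : ∀ t : ℕ, IsClassK (fun s => ψ (α s / (t + 1))) := fun t => by
    have := hψ.comp ((isClassKInf_const_mul (c := ((t : ℝ) + 1)⁻¹) (by positivity)).1.comp hα)
    simpa only [div_eq_inv_mul] using this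
  refine ⟨fun t => (hk t).1, fun t => (hk t).2.1, fun t => (hk t).2.2,
    fun s t hs => (hk t).nonneg hs, fun s hs t u htu => ?_, fun s hs => ?_⟩
  · have hαs : 0 < α s := by simpa [hα.2.1] using hα.2.2 self_mem_Ici hs.le hs
    have htu' : (t : ℝ) < u := by exact_mod_cast htu
    exact hψ.2.2 (by simp only [mem_Ici]; positivity) (by simp only [mem_Ici]; positivity)
      (by gcongr)
  · have hlim : Tendsto (fun t : ℕ => α s / ((t : ℝ) + 1)) atTop (𝓝[Ici 0] 0) := by
      refine tendsto_nhdsWithin_iff.2 ⟨?_, Eventually.of_forall fun t => ?_⟩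
      · simpa [div_eq_mul_inv] using
          (tendsto_one_div_add_atTop_nhds_zero_nat (𝕜 := ℝ)).const_mul (α s)
      · exact div_nonneg (hα.nonneg hs.le) (by positivity)
    have := (hψ.1 0 self_mem_Ici).tendsto.comp hlim
    rwa [hψ.2.1] at this

lemma IsClassK.add_le {γ : ℝ → ℝ} (h : IsClassK γ) {s r : ℝ} (hs : 0 ≤ s) (hr : 0 ≤ r) :
    γ (s + r) ≤ γ (2 * s) + γ (2 * r) := by
  rcases le_total s r with hsr | hsr
  · have h1 : γ (s + r) ≤ γ (2 * r) := h.mono (by positivity) (by linarith)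
    have h2 : 0 ≤ γ (2 * s) := h.nonneg (by positivity)
    linarith
  · have h1 : γ (s + r) ≤ γ (2 * s) := h.mono (by positivity) (by linarith)
    have h2 : 0 ≤ γ (2 * r) := h.nonneg (by positivity)
    linarith

/-- A nonnegative sequence decreasing by at least `κ (y t)` at step `t`, with `κ ≤ id`
monotone, satisfies `κ (y t) ≤ y 0 / (t + 1)`. -/
lemma le_div_of_decrease {κ : ℝ → ℝ} (hκ : IsClassK κ) (hκid : ∀ s, 0 ≤ s → κ s ≤ s)
    {y : ℕ → ℝ} (hy : ∀ t, 0 ≤ y t) (hstep : ∀ t, y (t + 1) ≤ y t - κ (y t)) (t : ℕ) :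
    κ (y t) ≤ y 0 / (t + 1) := by
  have hsum : ∀ t : ℕ, t * κ (y t) + y t ≤ y 0 := by
    intro t
    induction t with
    | zero => simp
    | succ t ih =>
      have hle : κ (y (t + 1)) ≤ κ (y t) :=
        hκ.mono (hy _) (by linarith [hstep t, hκ.nonneg (hy t)])
      have hmul := mul_le_mul_of_nonneg_left hle (show (0 : ℝ) ≤ t + 1 by positivity)
      push_cast
      linarith [hstep t]
  rw [le_div_iff₀ (by positivity)]
  linarith [hsum t, hκid _ (hy t)]

end ComparisonFunctions

/-- a discrete-time system admitting an ISpS-Lyapunov function is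
input-to-state practically stable (Limon et al. 2006). -/
theorem ISpS_of_Lyapunov (n q : ℕ)
    (g : EuclideanSpace ℝ (Fin n) → EuclideanSpace ℝ (Fin q) → EuclideanSpace ℝ (Fin n))
    (μ : ℝ) (hμ : 0 ≤ μ) (ρ : ℝ → ℝ) (hρ : IsClassK ρ)
    (V : EuclideanSpace ℝ (Fin n) → ℝ) (hV0 : ∀ x, 0 ≤ V x)
    (α₁ α₂ α₃ σ ρ₁ ρ₂ : ℝ → ℝ)
    (hα₁ : IsClassKInf α₁) (hα₂ : IsClassKInf α₂) (hα₃ : IsClassKInf α₃)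
    (hσ : IsClassKInf σ) (hρ₁ : IsClassK ρ₁) (hρ₂ : IsClassK ρ₂)
    (hbound : ∀ x, α₁ ‖x‖ ≤ V x ∧ V x ≤ α₂ ‖x‖ + σ μ)
    (hdecr : ∀ x, ∀ w : EuclideanSpace ℝ (Fin q), ‖w‖ ≤ ρ μ →
      V (g x w) - V x ≤ -α₃ ‖x‖ + ρ₁ ‖w‖ + ρ₂ μ) :
    ∃ (β : ℝ → ℕ → ℝ) (δ₁ δ₂ : ℝ → ℝ),
      IsClassKL β ∧ IsClassK δ₁ ∧ IsClassK δ₂ ∧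
      ∀ (x : ℕ → EuclideanSpace ℝ (Fin n)) (w : ℕ → EuclideanSpace ℝ (Fin q)),
        (∀ t, ‖w t‖ ≤ ρ μ) → (∀ t, x (t + 1) = g (x t) (w t)) →
        ∀ t, ‖x t‖ ≤ β ‖x 0‖ t + δ₁ (⨆ s : ℕ, ‖w s‖) + δ₂ μ := by
  obtain ⟨γ₁, hγ₁, -, hγ₁α₁⟩ := hα₁.exists_inverse
  obtain ⟨γ₃, hγ₃, hα₃γ₃, -⟩ := hα₃.exists_inverse
  let η : ℝ → ℝ := fun r => α₂ (γ₃ (2 * r)) + r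
  have hη : IsClassKInf η :=
    (hα₂.comp (hγ₃.comp (isClassKInf_const_mul two_pos))).add isClassKInf_id
  obtain ⟨κ, hκ, hηκ, -⟩ := hη.exists_inverse
  have hκ0 : ∀ s, 0 ≤ s → 0 ≤ κ s := fun s hs => hκ.1.nonneg hs
  have hκid : ∀ s, 0 ≤ s → κ s ≤ s := fun s hs => by
    have h1 : α₂ (γ₃ (2 * κ s)) + κ s = s := hηκ s hs
    have h2 := hα₂.1.nonneg (hγ₃.1.nonneg (mul_nonneg two_pos.le (hκ0 s hs)))
    linarith
  have hκα : ∀ s, 0 ≤ s → α₂ (γ₃ (2 * κ s)) ≤ s := fun s hs => by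
    have h1 : α₂ (γ₃ (2 * κ s)) + κ s = s := hηκ s hs
    linarith [hκ0 s hs]
  have hα₃_ge : ∀ (r s : ℝ), 0 ≤ r → 0 ≤ s → α₂ (γ₃ r) ≤ α₂ s → r ≤ α₃ s := by
    intro r s hr hs h
    rw [← hα₃γ₃ r hr]
    exact hα₃.1.mono (hγ₃.1.nonneg hr) (hα₂.1.le_of_le (hγ₃.1.nonneg hr) hs h)
  set d : ℝ := ρ₁ (ρ μ) + ρ₂ μ with hd
  have hd0 : 0 ≤ d := add_nonneg (hρ₁.nonneg (hρ.nonneg hμ)) (hρ₂.nonneg hμ)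
  have hd20 : 0 ≤ 2 * d := by positivity
  set b : ℝ := σ μ + α₂ (γ₃ (2 * d)) + d with hb
  have hσμ : 0 ≤ σ μ := hσ.1.nonneg hμ
  have hc0 : 0 ≤ α₂ (γ₃ (2 * d)) := hα₂.1.nonneg (hγ₃.1.nonneg hd20)
  have hb0 : 0 ≤ b := by positivity
  have hstep : ∀ x w, ‖w‖ ≤ ρ μ →
      max (V (g x w) - b) 0 ≤ max (V x - b) 0 - κ (max (V x - b) 0) := by
    intro x w hw
    have hV := hdecr x w hw
    have hρw := hρ₁.mono (norm_nonneg w) hw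
    have hα₃x := hα₃.1.nonneg (norm_nonneg x)
    have hup := (hbound x).2
    rcases le_total (V x) b with hVb | hVb
    · rw [max_eq_right (sub_nonpos.2 hVb), hκ.1.2.1, sub_zero]
      refine max_le ?_ le_rfl
      rcases le_total (V x) (σ μ + α₂ (γ₃ (2 * d))) with hVc | hVc
      · linarith
      · linarith [hα₃_ge (2 * d) ‖x‖ hd20 (norm_nonneg x) (by linarith)]
    · have hy : 0 ≤ V x - b := sub_nonneg.2 hVb
      rw [max_eq_left hy]
      have h1 := hα₃_ge (2 * d) ‖x‖ hd20 (norm_nonneg x) (by linarith)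
      have h2 := hα₃_ge (2 * κ (V x - b)) ‖x‖ (mul_nonneg two_pos.le (hκ0 _ hy)) (norm_nonneg x)
        (by linarith [hκα _ hy])
      exact max_le (by linarith) (by linarith [hκid _ hy])
  have hA0 : 0 ≤ γ₁ (2 * b) := hγ₁.1.nonneg (by positivity)
  have hψ : IsClassK (fun r => γ₁ (2 * η r)) :=
    (hγ₁.comp ((isClassKInf_const_mul two_pos).comp hη)).1
  refine ⟨fun s t => γ₁ (2 * η (α₂ s / (t + 1))), fun s => s, fun s => (1 + γ₁ (2 * b) / μ) * s,
    hψ.isClassKL_comp_div hα₂.1, isClassKInf_id.1,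
    (isClassKInf_const_mul (by positivity)).1, fun x w hw hx t => ?_⟩
  have hδ₁ : 0 ≤ ⨆ s : ℕ, ‖w s‖ := Real.iSup_nonneg fun s => norm_nonneg _
  have hδ₂ : γ₁ (2 * b) ≤ (1 + γ₁ (2 * b) / μ) * μ := by
    rcases hμ.eq_or_lt with rfl | hμ'
    · simp [hb, hd, hρ.2.1, hρ₁.2.1, hρ₂.2.1, hσ.1.2.1, hγ₃.1.2.1, hα₂.1.2.1, hγ₁.1.2.1]
    · rw [add_mul, div_mul_cancel₀ _ hμ'.ne']
      linarith
  set y : ℕ → ℝ := fun t => max (V (x t) - b) 0 with hydef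
  have hy : ∀ t, 0 ≤ y t := fun t => le_max_right _ _
  have hκy := le_div_of_decrease hκ.1 hκid hy
    (fun t => by simpa only [hydef, hx t] using hstep (x t) (w t) (hw t)) t
  have hy0 : y 0 ≤ α₂ ‖x 0‖ :=
    max_le (by linarith [(hbound (x 0)).2]) (hα₂.1.nonneg (norm_nonneg _))
  have hyt : y t ≤ η (α₂ ‖x 0‖ / (t + 1)) := by
    rw [← hηκ _ (hy t)]
    exact hη.1.mono (hκ0 _ (hy t)) (hκy.trans (by gcongr))
  calc ‖x t‖ = γ₁ (α₁ ‖x t‖) := (hγ₁α₁ _ (norm_nonneg _)).symm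
    _ ≤ γ₁ (y t + b) := hγ₁.1.mono (hα₁.1.nonneg (norm_nonneg _))
        (by linarith [(hbound (x t)).1, le_max_left (V (x t) - b) 0])
    _ ≤ γ₁ (2 * y t) + γ₁ (2 * b) := hγ₁.1.add_le (hy t) hb0
    _ ≤ γ₁ (2 * η (α₂ ‖x 0‖ / (t + 1))) + γ₁ (2 * b) := by
        gcongr
        exact hγ₁.1.mono (mul_nonneg two_pos.le (hy t)) (by linarith)
    _ ≤ _ := by linarith
end

section
/- Let (i,j) be a movement with i ∈ L_int and j ∈ L_i^out, let the state x be nonnegative, and let x⁺ := f(x,S,λ;C,R). Suppose x_{ij} ≤ C_{ij}S_{ij} and x_{ki} ≤ C_{ki}S_{ki} for every k ∈ L_i^in. Then x⁺_{ij} = R_{ij} · Σ_{k∈L_i^in} x_{ki}; consequently, if Σ_{k∈L_i^in} x_{ki} > 0, then R_{ij} = x⁺_{ij} / Σ_{k∈L_i^in} x_{ki}, i.e., the turn ratio R_{ij} is exactly determined from one observed transition. -/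
open Finset

/-- exact identification of the turn ratio `R_{ij}` from one observed
transition when all relevant queues are below their service capacities. -/
theorem turn_ratio_identification {L : Type*} [Fintype L] [DecidableEq L]
    (Lentry Lint : Finset L) (out : L → Finset L)
    (x S C R : L → L → ℝ) (lam : L → ℝ)
    (i j : L) (hi : i ∈ Lint) (hj : j ∈ out i)
    (hx : ∀ a ∈ Lentry ∪ Lint, ∀ b ∈ out a, 0 ≤ x a b)
    (hij : x i j ≤ C i j * S i j)
    (hki : ∀ k ∈ Lin out i, x k i ≤ C k i * S k i) :
    fdyn Lint out x S C R lam i j = R i j * ∑ k ∈ Lin out i, x k i ∧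
    (0 < ∑ k ∈ Lin out i, x k i →
      R i j = fdyn Lint out x S C R lam i j / ∑ k ∈ Lin out i, x k i) := by
  have h : fdyn Lint out x S C R lam i j = R i j * ∑ k ∈ Lin out i, x k i := by
    rw [fdyn, if_pos hi, max_eq_right (sub_nonpos.mpr hij), zero_add, Finset.mul_sum]
    exact Finset.sum_congr rfl fun k hk => by rw [min_eq_right (hki k hk)]
  exact ⟨h, fun hpos => by rw [h, mul_div_cancel_right₀ _ hpos.ne']⟩
end
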